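/- Suppose every utility function u_i is continuous, quasi-concave, and strictly increasing. Then there exists a pseudo-market equilibrium (x*, p*) such that x* is weakly 𝒞-constrained Pareto efficient. -/

import Mathlib

open Finset

noncomputable def dotO {O : Type*} [Fintype O] (p z : O → ℝ) : ℝ := ∑ l, p l * z l

noncomputable def dotIO {I O : Type*} [Fintype I] [Fintype O] (a x : I → O → ℝ) : ℝ :=
  ∑ i, ∑ l, a i l * x i l

noncomputable def pers {I O C : Type*} [Fintype C] (a : C → I → O → ℝ) (p : C → ℝ)
    (i : I) : O → ℝ :=
  fun l => ∑ c, a c i l * p c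

section FixedPoint

open MeasureTheory Metric Module
open scoped NNReal

theorem det_one_add_smul_eq_sum_lagrange {E : Type*} [AddCommGroup E] [Module ℝ E]
    [FiniteDimensional ℝ E] (L : E →ₗ[ℝ] E) {s : Finset ℝ} (hs : finrank ℝ E < #s) (t : ℝ) :
    LinearMap.det (1 + t • L) =
      ∑ j ∈ s, LinearMap.det (1 + j • L) * (Lagrange.basis s id j).eval t := by
  classical
  let B := finBasis ℝ E
  let M := LinearMap.toMatrix B B L
  let P : Polynomial ℝ :=
    Matrix.det ((Polynomial.X : Polynomial ℝ) • M.map Polynomial.C +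
      (1 : Matrix _ _ ℝ).map Polynomial.C)
  have hP (y : ℝ) : P.eval y = LinearMap.det (1 + y • L) := by
    rw [← LinearMap.det_toMatrix B, ← Polynomial.coe_evalRingHom, RingHom.map_det]
    congr 1
    ext i j
    simp [M, add_comm, Matrix.one_apply, apply_ite (Polynomial.eval y)]
    ring
  have hdeg : P.degree < #s := by
    refine (Polynomial.degree_le_natDegree).trans_lt ?_
    have := Polynomial.natDegree_det_X_add_C_le M 1
    rw [Fintype.card_fin] at this
    exact_mod_cast this.trans_lt hs
  have h := congrArg (Polynomial.eval t)
    (Lagrange.eq_interpolate (s := s) (v := id) (Function.injective_id.injOn) hdeg)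
  rw [Lagrange.interpolate_apply, Polynomial.eval_finsetSum, hP] at h
  simpa [hP] using h

variable {E : Type*} [NormedAddCommGroup E] [InnerProductSpace ℝ E] [FiniteDimensional ℝ E]

theorem ContinuousLinearMap.det_one_add_smul_pos {A : E →L[ℝ] E} {K t : ℝ} (hA : ‖A‖ ≤ K)
    (ht0 : 0 ≤ t) (ht : t * K < 1) : 0 < (1 + t • A).det := by
  have hne : ∀ s ∈ Set.Icc 0 t, (1 + s • A).det ≠ 0 := by
    intro s hs h0
    have hlt : ‖s • A‖ < 1 := by
      rw [norm_smul, Real.norm_of_nonneg hs.1]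
      calc s * ‖A‖ ≤ t * K := mul_le_mul hs.2 hA (norm_nonneg _) ht0
        _ < 1 := ht
    obtain ⟨v, hv, hv0⟩ := Submodule.exists_mem_ne_zero_of_ne_bot
      (p := LinearMap.ker ((1 + s • A : E →L[ℝ] E) : E →ₗ[ℝ] E))
      (LinearMap.bot_lt_ker_of_det_eq_zero h0).ne'
    have h1 : v = -((s • A) v) := by
      rw [← add_eq_zero_iff_eq_neg]
      simpa using hv
    have h2 : ‖v‖ ≤ ‖s • A‖ * ‖v‖ := by
      conv_lhs => rw [h1, norm_neg]
      exact (s • A).le_opNorm v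
    nlinarith [norm_pos_iff.2 hv0]
  have hcont : ContinuousOn (fun s : ℝ => (1 + s • A).det) (Set.Icc 0 t) :=
    (ContinuousLinearMap.continuous_det.comp (by fun_prop)).continuousOn
  by_contra! hle
  obtain ⟨s, hs, hs0⟩ := intermediate_value_Icc' ht0 hcont
    (show (0 : ℝ) ∈ Set.Icc _ _ from ⟨hle, by simp [ContinuousLinearMap.det]⟩)
  exact hne s hs hs0

theorem image_ball_add_smul {g : E → E} {K : ℝ≥0} {t : ℝ} (hg : LipschitzOnWith K g (closedBall 0 1))
    (hsph : ∀ x ∈ sphere (0 : E) 1, g x = 0) (hr : ∀ x ∈ closedBall (0 : E) 1, ‖x + g x‖ ≤ 1)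
    (ht0 : 0 ≤ t) (ht1 : t < 1) (ht : t * K < 1) :
    (fun x => x + t • g x) '' ball 0 1 = ball 0 1 ∧
      Set.InjOn (fun x => x + t • g x) (ball 0 1) := by
  set f : E → E := fun x => x + t • g x with hf
  have happ : ∀ x ∈ closedBall (0 : E) 1, ∀ y ∈ closedBall (0 : E) 1,
      ‖f x - f y - (x - y)‖ ≤ t * K * ‖x - y‖ := by
    intro x hx y hy
    have : f x - f y - (x - y) = t • (g x - g y) := by simp only [hf, smul_sub]; abel
    rw [this, norm_smul, Real.norm_of_nonneg ht0, mul_assoc]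
    exact mul_le_mul_of_nonneg_left (hg.norm_sub_le hx hy) ht0
  have hinj : Set.InjOn f (ball 0 1) := by
    intro x hx y hy hxy
    have := happ x (ball_subset_closedBall hx) y (ball_subset_closedBall hy)
    rw [hxy, sub_self, zero_sub, norm_neg] at this
    rw [← sub_eq_zero, ← norm_eq_zero]
    nlinarith [norm_nonneg (x - y)]
  have hsub : f '' ball 0 1 ⊆ ball 0 1 := by
    rintro _ ⟨x, hx, rfl⟩
    have h1 := hr x (ball_subset_closedBall hx)
    rw [mem_ball_zero_iff] at hx ⊢
    have : f x = (1 - t) • x + t • (x + g x) := by simp only [hf]; module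
    rw [this]
    calc ‖(1 - t) • x + t • (x + g x)‖ ≤ (1 - t) * ‖x‖ + t * ‖x + g x‖ := by
          refine (norm_add_le _ _).trans ?_
          rw [norm_smul, norm_smul, Real.norm_of_nonneg ht0, Real.norm_of_nonneg (by linarith)]
      _ < 1 := by nlinarith
  have hopen : IsOpen (f '' ball 0 1) := by
    have hal : ApproximatesLinearOn f (ContinuousLinearEquiv.refl ℝ E : E →L[ℝ] E) (ball 0 1)
        (t.toNNReal * K) := fun x hx y hy => by
      simpa [ht0] using happ x (ball_subset_closedBall hx) y (ball_subset_closedBall hy)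
    refine hal.open_image (ContinuousLinearEquiv.refl ℝ E).toNonlinearRightInverse isOpen_ball ?_
    rcases subsingleton_or_nontrivial E with h | h
    · exact Or.inl h
    · right
      have h1 : (ContinuousLinearEquiv.refl ℝ E).toNonlinearRightInverse.nnnorm = 1 :=
        ContinuousLinearMap.nnnorm_id
      rw [h1, inv_one, ← NNReal.coe_lt_coe]
      simpa [ht0] using ht
  have hcont : ContinuousOn f (closedBall 0 1) :=
    continuousOn_id.add (hg.continuousOn.const_smul t)
  have hclosed : IsClosed (f '' closedBall 0 1) :=
    ((isCompact_closedBall 0 1).image_of_continuousOn hcont).isClosed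
  refine ⟨hsub.antisymm ?_, hinj⟩
  refine (convex_ball (0 : E) 1).isPreconnected.subset_of_closure_inter_subset hopen ?_ ?_
  · exact ⟨f 0, hsub ⟨0, by simp, rfl⟩, 0, by simp, rfl⟩
  · rintro y ⟨hy, hy1⟩
    obtain ⟨x, hx, rfl⟩ := closure_minimal (Set.image_mono ball_subset_closedBall) hclosed hy
    refine ⟨x, ?_, rfl⟩
    rw [mem_closedBall_zero_iff] at hx
    rw [mem_ball_zero_iff] at hy1 ⊢
    refine lt_of_le_of_ne hx fun h => ?_
    rw [hf] at hy1
    simp only [hsph x (by simpa using h), smul_zero, add_zero] at hy1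
    exact hy1.ne h

theorem not_exists_contDiff_retraction_sphere [MeasurableSpace E] [BorelSpace E] {r : E → E}
    (hr : ∀ x ∈ closedBall (0 : E) 1, ContDiffAt ℝ 1 r x)
    (hnorm : ∀ x ∈ closedBall (0 : E) 1, ‖r x‖ = 1) :
    ¬ ∀ x ∈ sphere (0 : E) 1, r x = x := by
  intro hsph
  let A : E → E →L[ℝ] E := fun x => fderiv ℝ r x - 1
  have hd : ∀ x ∈ closedBall (0 : E) 1, HasFDerivAt r (fderiv ℝ r x) x := fun x hx =>
    ((hr x hx).differentiableAt one_ne_zero).hasFDerivAt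
  have hA : ContinuousOn A (closedBall 0 1) := fun x hx =>
    (((hr x hx).fderiv_right (m := 0) (by simp)).continuousAt.sub
      continuousAt_const).continuousWithinAt
  obtain ⟨K, hK⟩ : ∃ K : ℝ≥0, ∀ x ∈ closedBall (0 : E) 1, ‖A x‖₊ ≤ K := by
    obtain ⟨C, hC⟩ := (isCompact_closedBall (0 : E) 1).exists_bound_of_continuousOn hA
    exact ⟨C.toNNReal, fun x hx => NNReal.le_toNNReal_of_coe_le (hC x hx)⟩
  have hg : LipschitzOnWith K (fun x => r x - x) (closedBall 0 1) :=
    (convex_closedBall (0 : E) 1).lipschitzOnWith_of_nnnorm_hasFDerivWithin_le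
      (fun x hx => ((hd x hx).sub (hasFDerivAt_id x)).hasFDerivWithinAt) hK
  have hcont (t : ℝ) : ContinuousOn (fun x => (1 + t • A x).det) (closedBall 0 1) :=
    ContinuousLinearMap.continuous_det.comp_continuousOn
      (continuousOn_const.add (hA.const_smul t))
  have hint (t : ℝ) : IntegrableOn (fun x => (1 + t • A x).det) (ball 0 1) volume :=
    ((hcont t).integrableOn_compact (isCompact_closedBall 0 1)).mono_set ball_subset_closedBall
  have hvol : ∀ t : ℝ, 0 ≤ t → t < 1 → t * K < 1 →
      ∫ x in ball (0 : E) 1, (1 + t • A x).det = volume.real (ball (0 : E) 1) := by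
    intro t ht0 ht1 ht
    obtain ⟨him, hinj⟩ := image_ball_add_smul hg (fun x hx => by simp [hsph x hx])
      (fun x hx => by simp [hnorm x hx]) ht0 ht1 ht
    have := integral_image_eq_integral_abs_det_fderiv_smul volume measurableSet_ball
      (f' := fun x => 1 + t • A x)
      (fun x hx => ((hasFDerivAt_id x).add (((hd x (ball_subset_closedBall hx)).sub
        (hasFDerivAt_id x)).const_smul t)).hasFDerivWithinAt) hinj (fun _ => (1 : ℝ))
    change ∫ x in (fun x => x + t • (r x - x)) '' ball 0 1, (1 : ℝ) = _ at this
    rw [him, setIntegral_const, smul_eq_mul, mul_one] at this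
    rw [this]
    refine setIntegral_congr_fun measurableSet_ball fun x hx => ?_
    simp only [smul_eq_mul, mul_one]
    rw [abs_of_pos (ContinuousLinearMap.det_one_add_smul_pos
      (hK x (ball_subset_closedBall hx)) ht0 ht)]
  obtain ⟨s, hs, hcard⟩ := (Set.Ico_infinite
    (show (0 : ℝ) < min 1 ((K : ℝ) + 1)⁻¹ by positivity)).exists_subset_card_eq (finrank ℝ E + 1)
  have hone : ∫ x in ball (0 : E) 1, (1 + (1 : ℝ) • A x).det = volume.real (ball (0 : E) 1) := by
    have hdet (x : E) : (1 + (1 : ℝ) • A x).det =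
        ∑ j ∈ s, (1 + j • A x).det * (Lagrange.basis s id j).eval 1 :=
      det_one_add_smul_eq_sum_lagrange (A x : E →ₗ[ℝ] E) (by omega) 1
    simp_rw [hdet]
    rw [integral_finsetSum _ fun j _ => (hint j).mul_const _]
    have : ∀ j ∈ s, ∫ x in ball (0 : E) 1, (1 + j • A x).det * (Lagrange.basis s id j).eval 1 =
        volume.real (ball (0 : E) 1) * (Lagrange.basis s id j).eval 1 := by
      intro j hj
      obtain ⟨h0, h1⟩ := hs hj
      rw [lt_min_iff] at h1
      rw [integral_mul_const, hvol j h0 h1.1]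
      · have h2 := h1.2
        rw [← one_div, lt_div_iff₀ (by positivity)] at h2
        linarith
    rw [Finset.sum_congr rfl this, ← Finset.mul_sum, ← Polynomial.eval_finsetSum,
      Lagrange.sum_basis Function.injective_id.injOn (Finset.card_pos.1 (by omega))]
    simp
  have hzero : ∫ x in ball (0 : E) 1, (1 + (1 : ℝ) • A x).det = 0 := by
    refine setIntegral_eq_zero_of_forall_eq_zero fun x hx => ?_
    have hx' := ball_subset_closedBall hx
    have horth : ∀ v, inner ℝ (r x) (fderiv ℝ r x v) = 0 := by
      intro v
      have h1 : HasFDerivAt (fun y => ‖r y‖ ^ 2) (0 : E →L[ℝ] ℝ) x := by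
        refine (hasFDerivAt_const (1 : ℝ) x).congr_of_eventuallyEq ?_
        filter_upwards [isOpen_ball.mem_nhds hx] with y hy
        simp [hnorm y (ball_subset_closedBall hy)]
      have h2 := congrArg (fun L => L v) ((hd x hx').norm_sq.unique h1)
      simpa using h2
    by_contra hne
    have hsurj : Function.Surjective (fderiv ℝ r x) := by
      have he : (1 : E →L[ℝ] E) + (1 : ℝ) • A x = fderiv ℝ r x := by simp [A]
      rw [he] at hne
      exact (LinearEquiv.ofIsUnitDet (f := (fderiv ℝ r x : E →ₗ[ℝ] E)) (v := finBasis ℝ E)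
        (v' := finBasis ℝ E) (by
          rw [LinearMap.det_toMatrix]; exact isUnit_iff_ne_zero.2 hne)).surjective
    obtain ⟨v, hv⟩ := hsurj (r x)
    have := horth v
    rw [hv, real_inner_self_eq_norm_sq, hnorm x hx'] at this
    norm_num at this
  rw [hone] at hzero
  exact (ENNReal.toReal_pos (measure_ball_pos volume (0 : E) one_pos).ne'
    measure_ball_lt_top.ne).ne' hzero

theorem exists_fixedPoint_of_contDiff_of_norm_le_one {g : E → E} (hg : ContDiff ℝ 1 g)
    (hg1 : ∀ x, ‖g x‖ ≤ 1) : ∃ x, g x = x := by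
  let : MeasurableSpace E := borel E
  have : BorelSpace E := ⟨rfl⟩
  by_contra! hne
  let v : E → E := fun x => x - g x
  let b : E → ℝ := fun x => inner ℝ x (v x)
  let D : E → ℝ := fun x => b x ^ 2 + ‖v x‖ ^ 2 * (1 - ‖x‖ ^ 2)
  have hv : ∀ x, 0 < ‖v x‖ ^ 2 := fun x => by
    have : v x ≠ 0 := sub_ne_zero.2 (hne x).symm
    positivity
  have hb : ∀ x, ‖x‖ = 1 → 0 < b x := by
    intro x hx
    have h1 : ‖v x‖ ^ 2 = ‖x‖ ^ 2 - 2 * inner ℝ x (g x) + ‖g x‖ ^ 2 := norm_sub_sq_real x (g x)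
    have h2 : b x = ‖x‖ ^ 2 - inner ℝ x (g x) := by
      simp only [b, v, inner_sub_right, real_inner_self_eq_norm_sq]
    have h3 : ‖g x‖ ^ 2 ≤ 1 := pow_le_one₀ (norm_nonneg _) (hg1 x)
    have := hv x
    rw [hx] at h1 h2
    linarith
  have hD : ∀ x ∈ closedBall (0 : E) 1, 0 < D x := by
    intro x hx
    rw [mem_closedBall_zero_iff] at hx
    rcases hx.lt_or_eq with h | h
    · have : 0 < 1 - ‖x‖ ^ 2 := by nlinarith [norm_nonneg x]
      have := mul_pos (hv x) this
      positivity
    · have := hb x h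
      simp only [D, h]
      positivity
  let r : E → E := fun x => x + ((-b x + √(D x)) / ‖v x‖ ^ 2) • v x
  have hvc : ContDiff ℝ 1 v := contDiff_id.sub hg
  have hbc : ContDiff ℝ 1 b := contDiff_id.inner ℝ hvc
  have hDc : ContDiff ℝ 1 D :=
    (hbc.pow 2).add ((hvc.norm_sq ℝ).mul (contDiff_const.sub (contDiff_id.norm_sq ℝ)))
  refine not_exists_contDiff_retraction_sphere (r := r) ?_ ?_ ?_
  · intro x hx
    exact contDiffAt_id.add (((hbc.contDiffAt.neg.add
      (hDc.contDiffAt.sqrt (hD x hx).ne')).div (hvc.norm_sq ℝ).contDiffAt (hv x).ne').smul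
      hvc.contDiffAt)
  · intro x hx
    have hs : √(D x) ^ 2 = D x := Real.sq_sqrt (hD x hx).le
    have h1 : ‖r x‖ ^ 2 = 1 := by
      have := (hv x).ne'
      simp only [r]
      rw [norm_add_sq_real, inner_smul_right, norm_smul, mul_pow, Real.norm_eq_abs, sq_abs]
      change _ + 2 * (_ * b x) + _ = _
      have hl : (-b x + √(D x)) / ‖v x‖ ^ 2 * ‖v x‖ ^ 2 = -b x + √(D x) := div_mul_cancel₀ _ this
      generalize (-b x + √(D x)) / ‖v x‖ ^ 2 = l at hl ⊢
      refine mul_left_cancel₀ this ?_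
      have hDx : D x = b x ^ 2 + ‖v x‖ ^ 2 * (1 - ‖x‖ ^ 2) := rfl
      linear_combination (l * ‖v x‖ ^ 2 + b x + √(D x)) * hl + hs + hDx
    exact (pow_eq_one_iff_of_nonneg (norm_nonneg _) two_ne_zero).1 h1
  · intro x hx
    rw [mem_sphere_zero_iff_norm] at hx
    have : √(D x) = b x := by
      simp only [D, hx]
      simp [Real.sqrt_sq (hb x hx).le]
    simp [r, this]

theorem exists_fixedPoint_of_contDiff_of_isBounded_range {F : Type*} [NormedAddCommGroup F]
    [NormedSpace ℝ F] [FiniteDimensional ℝ F] {g : F → F} (hg : ContDiff ℝ 1 g)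
    (hb : Bornology.IsBounded (Set.range g)) : ∃ x, g x = x := by
  let e := toEuclidean (E := F)
  obtain ⟨R, hR0, hR⟩ := (e.lipschitz.isBounded_image hb).exists_pos_norm_le
  obtain ⟨y, hy⟩ := exists_fixedPoint_of_contDiff_of_norm_le_one
    (g := fun y => R⁻¹ • e (g (e.symm (R • y))))
    ((e.contDiff.comp (hg.comp (e.symm.contDiff.comp (contDiff_id.const_smul R)))).const_smul R⁻¹)
    (fun y => by
      rw [norm_smul, Real.norm_of_nonneg (by positivity), inv_mul_le_one₀ hR0]
      exact hR _ ⟨_, ⟨_, rfl⟩, rfl⟩)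
  refine ⟨e.symm (R • y), e.injective ?_⟩
  rw [e.apply_symm_apply]
  conv_rhs => rw [← hy]
  rw [smul_inv_smul₀ hR0.ne']

/-- Browder's fixed point theorem for correspondences with locally constant selections. -/
theorem Convex.exists_mem_of_local_const {F : Type*} [NormedAddCommGroup F]
    [NormedSpace ℝ F] [FiniteDimensional ℝ F] {K : Set F} (hK : IsCompact K) (hKc : Convex ℝ K)
    (hKne : K.Nonempty) {T : F → Set F} (hT : ∀ x ∈ K, Convex ℝ (T x))
    (hloc : ∀ x ∈ K, ∃ y ∈ K, ∀ᶠ z in nhdsWithin x K, y ∈ T z) : ∃ x ∈ K, x ∈ T x := by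
  classical
  let T' : F → Set F := fun x => if x ∈ K then T x ∩ K else K
  have hT' : ∀ x, Convex ℝ (T' x) := by
    intro x
    by_cases hx : x ∈ K
    · simpa [T', hx] using (hT x hx).inter hKc
    · simpa [T', hx] using hKc
  have hT'K : ∀ x, T' x ⊆ K := by
    intro x
    by_cases hx : x ∈ K <;> simp [T', hx]
  obtain ⟨g, hg⟩ := exists_contMDiffMap_forall_mem_convex_of_local_const (n := 1)
    (modelWithCornersSelf ℝ F) (t := T') hT' (fun x => by
      by_cases hx : x ∈ K
      · obtain ⟨y, hy, h⟩ := hloc x hx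
        refine ⟨y, ?_⟩
        filter_upwards [eventually_nhdsWithin_iff.1 h] with z hz
        by_cases hzK : z ∈ K
        · simpa [T', hzK] using ⟨hz hzK, hy⟩
        · simpa [T', hzK] using hy
      · obtain ⟨y, hy⟩ := hKne
        refine ⟨y, ?_⟩
        filter_upwards [hK.isClosed.isOpen_compl.mem_nhds hx] with z hz
        have hz : z ∉ K := hz
        simpa [T', hz] using hy)
  obtain ⟨x, hx⟩ := exists_fixedPoint_of_contDiff_of_isBounded_range g.contMDiff.contDiff
    (hK.isBounded.subset (Set.range_subset_iff.2 fun x => hT'K x (hg x)))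
  have h := hg x
  rw [hx] at h
  have hxK := hT'K x h
  exact ⟨x, hxK, by simpa [T', hxK] using h⟩

/-- Joint maximal elements for finitely many convex-valued, irreflexive relations
with open lower sections. -/
theorem exists_forall_inter_eq_empty {F ι : Type*} [NormedAddCommGroup F]
    [NormedSpace ℝ F] [FiniteDimensional ℝ F] [Finite ι] {K : Set F} (hK : IsCompact K)
    (hKc : Convex ℝ K) (hKne : K.Nonempty) {A : ι → F → Set F}
    (hA : ∀ j, ∀ x ∈ K, Convex ℝ (A j x)) (hirr : ∀ j, ∀ x ∈ K, x ∉ A j x)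
    (hopen : ∀ j, ∀ x ∈ K, ∀ y ∈ K, y ∈ A j x → ∀ᶠ z in nhdsWithin x K, y ∈ A j z)
    (hprod : ∀ x ∈ K, ∀ s : Set ι, (∀ j ∈ s, (A j x ∩ K).Nonempty) →
      ∃ y ∈ K, ∀ j ∈ s, y ∈ A j x) :
    ∃ x ∈ K, ∀ j, A j x ∩ K = ∅ := by
  by_contra! hne
  have : CompactSpace K := isCompact_iff_compactSpace.1 hK
  let U : ι → Set K := fun j => {x | (A j x ∩ K).Nonempty}
  have hU : ∀ j, IsOpen (U j) := by
    intro j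
    rw [isOpen_iff_mem_nhds]
    rintro ⟨x, hx⟩ ⟨y, hyA, hyK⟩
    have := hopen j x hx y hyK hyA
    rw [nhdsWithin_eq_map_subtype_coe hx, Filter.eventually_map] at this
    filter_upwards [this] with z hz
    exact ⟨y, hz, hyK⟩
  obtain ⟨V, hVU, hVc, hVsub⟩ := exists_iUnion_eq_closed_subset hU (fun _ => Set.toFinite _)
    (Set.eq_univ_of_forall fun x => Set.mem_iUnion.2 (hne x x.2))
  let W : ι → Set F := fun j => Subtype.val '' V j
  have hWc : ∀ j, IsClosed (W j) := fun j =>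
    ((hVc j).isCompact.image continuous_subtype_val).isClosed
  obtain ⟨x, hx, hxT⟩ := Convex.exists_mem_of_local_const hK hKc hKne
    (T := fun x => ⋂ j ∈ {j | x ∈ W j}, A j x)
    (fun x hx => convex_iInter₂ fun j _ => hA j x hx) (by
      intro x hx
      obtain ⟨y, hyK, hy⟩ := hprod x hx {j | x ∈ W j} (by
        rintro j ⟨x, hxV, rfl⟩
        exact hVsub j hxV)
      refine ⟨y, hyK, ?_⟩
      simp only [Set.mem_iInter₂]
      refine Filter.eventually_all.2 fun j => ?_
      by_cases hj : x ∈ W j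
      · filter_upwards [hopen j x hx y hyK (hy j hj)] with z hz _ using hz
      · filter_upwards [mem_nhdsWithin_of_mem_nhds ((hWc j).isOpen_compl.mem_nhds hj)]
          with z hz h using absurd h hz)
  obtain ⟨j, hj⟩ := Set.mem_iUnion.1 (hVU ▸ Set.mem_univ (⟨x, hx⟩ : K))
  exact hirr j x hx (Set.mem_iInter₂.1 hxT j ⟨_, hj, rfl⟩)

end FixedPoint

section PseudoMarket

variable {I O C : Type*} [Fintype I] [Fintype O] [Fintype C]

theorem sum_dotO_pers (a : C → I → O → ℝ) (p : C → ℝ) (x : I → O → ℝ) :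
    ∑ i, dotO (pers a p i) (x i) = ∑ c, p c * dotIO (a c) x := by
  simp only [dotO, pers, dotIO, Finset.mul_sum, Finset.sum_mul]
  calc ∑ i, ∑ l, ∑ c, a c i l * p c * x i l = ∑ i, ∑ c, ∑ l, a c i l * p c * x i l :=
        Finset.sum_congr rfl fun i _ => Finset.sum_comm
    _ = ∑ c, ∑ i, ∑ l, a c i l * p c * x i l := Finset.sum_comm
    _ = _ := by simp only [mul_assoc, mul_left_comm]

theorem dotO_zero (p : O → ℝ) : dotO p 0 = 0 := by simp [dotO]

theorem dotO_add (p z w : O → ℝ) : dotO p (z + w) = dotO p z + dotO p w := by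
  simp [dotO, mul_add, Finset.sum_add_distrib]

theorem dotO_smul (p z : O → ℝ) (t : ℝ) : dotO p (t • z) = t * dotO p z := by
  simp [dotO, Finset.mul_sum, mul_left_comm]

theorem dotO_le_dotO {p z w : O → ℝ} (hp : ∀ l, 0 ≤ p l) (h : ∀ l, z l ≤ w l) :
    dotO p z ≤ dotO p w :=
  Finset.sum_le_sum fun l _ => mul_le_mul_of_nonneg_left (h l) (hp l)

theorem isCompact_priceSet {b : C → ℝ} (hb : ∀ c, 0 < b c) (N : ℝ) :
    IsCompact {p : C → ℝ | (∀ c, 0 ≤ p c) ∧ ∑ c, p c * b c ≤ N} := by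
  refine (isCompact_Icc (a := (0 : C → ℝ)) (b := fun c => N / b c)).of_isClosed_subset ?_ ?_
  · exact (isClosed_Ici (a := (0 : C → ℝ))).inter
      (isClosed_le (f := fun p : C → ℝ => ∑ c, p c * b c) (by fun_prop) continuous_const)
  · rintro p ⟨hp, hpN⟩
    refine ⟨hp, fun c => ?_⟩
    rw [le_div_iff₀ (hb c)]
    exact (Finset.single_le_sum (f := fun c => p c * b c)
      (fun c _ => mul_nonneg (hp c) (hb c).le) (Finset.mem_univ c)).trans hpN

theorem convex_priceSet (b : C → ℝ) (N : ℝ) :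
    Convex ℝ {p : C → ℝ | (∀ c, 0 ≤ p c) ∧ ∑ c, p c * b c ≤ N} := by
  rintro p ⟨hp, hpN⟩ q ⟨hq, hqN⟩ s t hs ht hst
  refine ⟨fun c => add_nonneg (mul_nonneg hs (hp c)) (mul_nonneg ht (hq c)), ?_⟩
  have : ∑ c, (s • p + t • q) c * b c = s * ∑ c, p c * b c + t * ∑ c, q c * b c := by
    simp [Finset.mul_sum, add_mul, Finset.sum_add_distrib, mul_assoc]
  rw [this]
  calc s * ∑ c, p c * b c + t * ∑ c, q c * b c ≤ s * N + t * N := by gcongr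
    _ = N := by rw [← add_mul, hst, one_mul]

theorem exists_quasi_equilibrium {X : I → Set (O → ℝ)}
    (hXnn : ∀ i, ∀ z ∈ X i, ∀ l, 0 ≤ z l) (hXcpt : ∀ i, IsCompact (X i))
    (hXcvx : ∀ i, Convex ℝ (X i)) (hX0 : ∀ i, (0 : O → ℝ) ∈ X i)
    (a : C → I → O → ℝ) {b : C → ℝ} (hb : ∀ c, 0 < b c) {N : ℝ} (hN : 0 ≤ N)
    {u : I → (O → ℝ) → ℝ} (hu_cont : ∀ i, ContinuousOn (u i) {z : O → ℝ | ∀ l, 0 ≤ z l})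
    (hu_qc : ∀ i, ∀ z ∈ {z : O → ℝ | ∀ l, 0 ≤ z l}, ∀ w ∈ {z : O → ℝ | ∀ l, 0 ≤ z l},
      ∀ t : ℝ, 0 ≤ t → t ≤ 1 → min (u i z) (u i w) ≤ u i (t • z + (1 - t) • w)) :
    ∃ (x : I → O → ℝ) (p : C → ℝ), (∀ i, x i ∈ X i) ∧ (∀ c, 0 ≤ p c) ∧ ∑ c, p c * b c ≤ N ∧
      (∀ i, dotO (pers a p i) (x i) ≤ 1 ∧
        ∀ z ∈ X i, dotO (pers a p i) z < 1 → u i z ≤ u i (x i)) ∧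
      ∀ q : C → ℝ, (∀ c, 0 ≤ q c) → ∑ c, q c * b c ≤ N →
        ∑ c, q c * (dotIO (a c) x - b c) ≤ ∑ c, p c * (dotIO (a c) x - b c) := by
  classical
  let K : Set ((I → O → ℝ) × (C → ℝ)) :=
    Set.univ.pi X ×ˢ {p : C → ℝ | (∀ c, 0 ≤ p c) ∧ ∑ c, p c * b c ≤ N}
  let V : (C → ℝ) → (I → O → ℝ) → ℝ := fun q x => ∑ c, q c * (dotIO (a c) x - b c)
  let A : Option I → (I → O → ℝ) × (C → ℝ) → Set ((I → O → ℝ) × (C → ℝ)) := fun j x =>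
    j.elim {y | V x.2 x.1 < V y.2 x.1} fun i =>
      {y | y.1 i ∈ X i ∧ dotO (pers a x.2 i) (y.1 i) < 1 ∧
        (dotO (pers a x.2 i) (x.1 i) ≤ 1 → u i (x.1 i) < u i (y.1 i))}
  have hVcont (q : C → ℝ) : Continuous (V q) := by
    simp only [V, dotIO]
    fun_prop
  have hVcont' : Continuous fun x : (I → O → ℝ) × (C → ℝ) => V x.2 x.1 := by
    simp only [V, dotIO]
    fun_prop
  have hdcont (i : I) (z : O → ℝ) :
      Continuous fun x : (I → O → ℝ) × (C → ℝ) => dotO (pers a x.2 i) z := by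
    simp only [dotO, pers]
    fun_prop
  have hdcont' (i : I) :
      Continuous fun x : (I → O → ℝ) × (C → ℝ) => dotO (pers a x.2 i) (x.1 i) := by
    simp only [dotO, pers]
    fun_prop
  have h0price : (0 : C → ℝ) ∈ {p : C → ℝ | (∀ c, 0 ≤ p c) ∧ ∑ c, p c * b c ≤ N} := by
    simpa using hN
  obtain ⟨⟨x, p⟩, ⟨hxX, hp⟩, hmax⟩ := exists_forall_inter_eq_empty (K := K) (A := A)
    ((isCompact_univ_pi hXcpt).prod (isCompact_priceSet hb N))
    ((convex_pi fun i _ => hXcvx i).prod (convex_priceSet b N))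
    ⟨(0, 0), fun i _ => hX0 i, h0price⟩
    (by
      rintro (_ | i) x hx y hy w hw s t hs ht hst
      · have hy : V x.2 x.1 < V y.2 x.1 := hy
        have hw : V x.2 x.1 < V w.2 x.1 := hw
        change V x.2 x.1 < V (s • y + t • w).2 x.1
        have : V (s • y + t • w).2 x.1 = s * V y.2 x.1 + t * V w.2 x.1 := by
          simp [V, Finset.mul_sum, add_mul, Finset.sum_add_distrib, mul_assoc]
        rw [this]
        exact convex_Ioi (𝕜 := ℝ) (V x.2 x.1) hy hw hs ht hst
      · obtain ⟨hy1, hy2, hy3⟩ := hy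
        obtain ⟨hw1, hw2, hw3⟩ := hw
        refine ⟨hXcvx i hy1 hw1 hs ht hst, ?_, fun h => ?_⟩
        · change dotO (pers a x.2 i) (s • y.1 i + t • w.1 i) < 1
          rw [dotO_add, dotO_smul, dotO_smul]
          exact convex_Iio (𝕜 := ℝ) (1 : ℝ) hy2 hw2 hs ht hst
        · have := hu_qc i (y.1 i) (hXnn i _ hy1) (w.1 i) (hXnn i _ hw1) s hs (by linarith)
          rw [← eq_sub_iff_add_eq'.2 hst] at this
          exact (lt_min (hy3 h) (hw3 h)).trans_le this)
    (by
      rintro (_ | i) x hx h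
      · exact lt_irrefl (V x.2 x.1) h
      · exact lt_irrefl _ (h.2.2 h.2.1.le))
    (by
      rintro (_ | i) x hx y hy h
      · have h : V x.2 x.1 < V y.2 x.1 := h
        exact mem_nhdsWithin_of_mem_nhds ((isOpen_lt hVcont'
          ((hVcont y.2).comp continuous_fst)).mem_nhds h)
      · obtain ⟨h1, h2, h3⟩ := h
        have e2 : ∀ᶠ z in nhdsWithin x K, dotO (pers a z.2 i) (y.1 i) < 1 :=
          mem_nhdsWithin_of_mem_nhds ((isOpen_lt (hdcont i (y.1 i)) continuous_const).mem_nhds h2)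
        by_cases hle : dotO (pers a x.2 i) (x.1 i) ≤ 1
        · have hc : ContinuousWithinAt (fun z : (I → O → ℝ) × (C → ℝ) => u i (z.1 i)) K x :=
            ((hu_cont i) (x.1 i) (hXnn i _ (hx.1 i trivial))).comp
              (f := fun z : (I → O → ℝ) × (C → ℝ) => z.1 i) (by fun_prop)
              fun z hz => hXnn i _ (hz.1 i trivial)
          filter_upwards [e2, hc.eventually_lt_const (h3 hle)] with z hz2 hz3
          exact ⟨h1, hz2, fun _ => hz3⟩
        · have e3 : ∀ᶠ z in nhdsWithin x K, 1 < dotO (pers a z.2 i) (z.1 i) :=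
            mem_nhdsWithin_of_mem_nhds
              ((isOpen_lt continuous_const (hdcont' i)).mem_nhds (not_le.1 hle))
          filter_upwards [e2, e3] with z hz2 hz3
          exact ⟨h1, hz2, fun h => absurd h hz3.not_ge⟩)
    (by
      intro x hx s hs
      choose! w hw using hs
      refine ⟨(fun i => if some i ∈ s then (w (some i)).1 i else 0,
        if none ∈ s then (w none).2 else 0), ⟨fun i _ => ?_, ?_⟩, ?_⟩
      · by_cases hi : some i ∈ s
        · simpa [hi] using (hw _ hi).2.1 i trivial
        · simpa [hi] using hX0 i
      · by_cases hi : none ∈ s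
        · simpa [hi] using (hw _ hi).2.2
        · simpa [hi] using hN
      · rintro (_ | i) hi
        · simpa [A, hi] using (hw _ hi).1
        · simpa [A, hi] using (hw _ hi).1)
  have hcons (i : I) (z : O → ℝ) (hz : z ∈ X i) (hz1 : dotO (pers a p i) z < 1) :
      ¬ (dotO (pers a p i) (x i) ≤ 1 → u i (x i) < u i z) := by
    intro h
    refine Set.eq_empty_iff_forall_notMem.1 (hmax (some i)) (Function.update x i z, p) ⟨?_, ?_, hp⟩
    · simpa [A] using ⟨hz, hz1, h⟩
    · intro k _
      by_cases hk : k = i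
      · subst hk
        simpa using hz
      · simpa [hk] using hxX k trivial
  refine ⟨x, p, fun i => hxX i trivial, hp.1, hp.2, fun i => ?_, fun q hq hqN => ?_⟩
  · refine ⟨?_, fun z hz hz1 => ?_⟩
    · by_contra h
      exact hcons i 0 (hX0 i) (by rw [dotO_zero]; exact one_pos) fun h' => absurd h' h
    · by_contra! h
      exact hcons i z hz hz1 fun _ => h
  · by_contra! h
    exact Set.eq_empty_iff_forall_notMem.1 (hmax none) (x, q) ⟨h, hxX, hq, hqN⟩

theorem le_of_forall_dotO_lt_one {Y : Set (O → ℝ)} (hYnn : ∀ z ∈ Y, ∀ l, 0 ≤ z l)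
    (hYcvx : Convex ℝ Y) (hY0 : (0 : O → ℝ) ∈ Y) {v : (O → ℝ) → ℝ}
    (hv : ContinuousOn v {z : O → ℝ | ∀ l, 0 ≤ z l}) {p : O → ℝ} {r : ℝ}
    (h : ∀ z ∈ Y, dotO p z < 1 → v z ≤ r) {z : O → ℝ} (hz : z ∈ Y) (hz1 : dotO p z ≤ 1) :
    v z ≤ r := by
  have hmem : ∀ᶠ t : ℝ in nhdsWithin 1 (Set.Iio 1), 0 < t ∧ t < 1 :=
    Ioo_mem_nhdsLT one_pos
  have htend : Filter.Tendsto (fun t : ℝ => v (t • z)) (nhdsWithin 1 (Set.Iio 1)) (nhds (v z)) := by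
    refine (hv z (hYnn z hz)).tendsto.comp (tendsto_nhdsWithin_iff.2 ⟨?_, ?_⟩)
    · have : Continuous fun t : ℝ => t • z := by fun_prop
      simpa using (this.tendsto 1).mono_left nhdsWithin_le_nhds
    · filter_upwards [hmem] with t ht l using mul_nonneg ht.1.le (hYnn z hz l)
  refine le_of_tendsto htend ?_
  filter_upwards [hmem] with t ht
  refine h _ (hYcvx.smul_mem_of_zero_mem hY0 hz ⟨ht.1.le, ht.2.le⟩) ?_
  rw [dotO_smul]
  nlinarith [ht.1, ht.2]

theorem feasible_of_forall_price_le {b e p : C → ℝ} (hb : ∀ c, 0 < b c) {N : ℝ} (hN : 0 < N)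
    (hp : ∀ c, 0 ≤ p c) (hpN : ∑ c, p c * b c ≤ N)
    (hwalras : ∑ c, p c * e c ≤ N - ∑ c, p c * b c)
    (hmax : ∀ q : C → ℝ, (∀ c, 0 ≤ q c) → ∑ c, q c * b c ≤ N →
      ∑ c, q c * e c ≤ ∑ c, p c * e c) :
    (∀ c, e c ≤ 0) ∧ ∀ c, p c * e c = 0 := by
  classical
  have he : ∀ c, e c ≤ 0 := by
    intro c
    rcases hpN.lt_or_eq with hlt | heq
    · have hd : 0 < (N - ∑ c, p c * b c) / b c := div_pos (sub_pos.2 hlt) (hb c)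
      have := hmax (p + Pi.single c ((N - ∑ c, p c * b c) / b c))
        (fun k => add_nonneg (hp k) ((Pi.single_nonneg.2 hd.le : (0 : C → ℝ) ≤ _) k)) (by
          simp [add_mul, Finset.sum_add_distrib, Pi.single_apply, div_mul_cancel₀ _ (hb c).ne'])
      simp only [Pi.add_apply, add_mul, Finset.sum_add_distrib, Pi.single_apply, ite_mul, zero_mul,
        Finset.sum_ite_eq', Finset.mem_univ, if_true] at this
      exact nonpos_of_mul_nonpos_right (by linarith) hd
    · have hd : 0 < N / b c := div_pos hN (hb c)
      have := hmax (Pi.single c (N / b c))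
        (fun k => (Pi.single_nonneg.2 hd.le : (0 : C → ℝ) ≤ _) k) (by
          simp [Pi.single_apply, div_mul_cancel₀ _ (hb c).ne'])
      simp only [Pi.single_apply, ite_mul, zero_mul,
        Finset.sum_ite_eq', Finset.mem_univ, if_true] at this
      exact nonpos_of_mul_nonpos_right (by linarith) hd
  have hterm : ∀ c ∈ Finset.univ, p c * e c ≤ 0 := fun c _ =>
    mul_nonpos_of_nonneg_of_nonpos (hp c) (he c)
  have hsum : 0 ≤ ∑ c, p c * e c := by simpa using hmax 0 (by simp) (by simpa using hN.le)
  exact ⟨he, fun c => (Finset.sum_eq_zero_iff_of_nonpos hterm).1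
    ((Finset.sum_nonpos hterm).antisymm hsum) c (Finset.mem_univ c)⟩

end PseudoMarket

theorem statement1 {I O C : Type*} [Fintype I] [Fintype O] [Fintype C]
    [Nonempty I] [Nonempty O]
    (S : Finset (I → O → ℝ)) (hSne : S.Nonempty)
    (𝒞 : Set (I → O → ℝ)) (h𝒞 : 𝒞 = convexHull ℝ (S : Set (I → O → ℝ)))
    (h𝒞nn : ∀ x ∈ 𝒞, ∀ i l, 0 ≤ x i l)
    (X : I → Set (O → ℝ))
    (hXnn : ∀ i, ∀ z ∈ X i, ∀ l, 0 ≤ z l)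
    (hXcpt : ∀ i, IsCompact (X i))
    (hXcvx : ∀ i, Convex ℝ (X i))
    (hX0 : ∀ i, (0 : O → ℝ) ∈ X i)
    (hXdc : ∀ i, ∀ y z : O → ℝ, (∀ l, 0 ≤ y l) → (∀ l, y l ≤ z l) → z ∈ X i → y ∈ X i)
    (a : C → I → O → ℝ) (b : C → ℝ)
    (ha : ∀ c i l, 0 ≤ a c i l) (hb : ∀ c, 0 < b c)
    (hlcs : {x : I → O → ℝ | (∀ i l, 0 ≤ x i l) ∧ ∃ x' ∈ 𝒞, ∀ i l, x i l ≤ x' i l}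
      = {x : I → O → ℝ | (∀ i l, 0 ≤ x i l) ∧ (∀ i, x i ∈ X i) ∧ ∀ c, dotIO (a c) x ≤ b c})
    (u : I → (O → ℝ) → ℝ)
    (hu_cont : ∀ i, ContinuousOn (u i) {z : O → ℝ | ∀ l, 0 ≤ z l})
    (hu_qc : ∀ i, ∀ z ∈ {z : O → ℝ | ∀ l, 0 ≤ z l}, ∀ w ∈ {z : O → ℝ | ∀ l, 0 ≤ z l},
      ∀ t : ℝ, 0 ≤ t → t ≤ 1 → min (u i z) (u i w) ≤ u i (t • z + (1 - t) • w))
    (hu_mono : ∀ i, ∀ z ∈ {z : O → ℝ | ∀ l, 0 ≤ z l}, ∀ w ∈ {z : O → ℝ | ∀ l, 0 ≤ z l},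
      (∀ l, w l ≤ z l) → w ≠ z → u i w < u i z)
    :
    ∃ (x : I → O → ℝ) (p : C → ℝ),
      (∀ c, 0 ≤ p c) ∧
      (∀ i, x i ∈ X i ∧ dotO (pers a p i) (x i) ≤ 1 ∧
        ∀ z ∈ X i, dotO (pers a p i) z ≤ 1 → u i z ≤ u i (x i)) ∧
      x ∈ 𝒞 ∧
      (∀ c, dotIO (a c) x < b c → p c = 0) ∧
      (¬ ∃ y ∈ 𝒞, ∀ i, u i (x i) < u i (y i)) := by
  have hN : (0 : ℝ) < Fintype.card I := by exact_mod_cast Fintype.card_pos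
  obtain ⟨x, p, hxX, hp, hpN, hcons, hmax⟩ :=
    exists_quasi_equilibrium hXnn hXcpt hXcvx hX0 a hb hN.le hu_cont hu_qc
  have hsplit (y : I → O → ℝ) : ∑ c, p c * (dotIO (a c) y - b c) =
      ∑ i, dotO (pers a p i) (y i) - ∑ c, p c * b c := by
    simp [sum_dotO_pers, mul_sub]
  have hbudget : ∑ i, dotO (pers a p i) (x i) ≤ Fintype.card I := by
    simpa using Finset.sum_le_sum fun i (_ : i ∈ Finset.univ) => (hcons i).1
  obtain ⟨hfeas, hslack⟩ := feasible_of_forall_price_le hb hN hp hpN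
    (by rw [hsplit]; linarith) hmax
  have hvalue : ∑ i, dotO (pers a p i) (x i) = ∑ c, p c * b c := by
    have := hsplit x
    rw [Finset.sum_eq_zero fun c _ => hslack c] at this
    linarith
  have hopt (i : I) (z : O → ℝ) (hz : z ∈ X i) (hz1 : dotO (pers a p i) z ≤ 1) :
      u i z ≤ u i (x i) :=
    le_of_forall_dotO_lt_one (hXnn i) (hXcvx i) (hX0 i) (hu_cont i) (hcons i).2 hz hz1
  have h𝒞feas (y : I → O → ℝ) (hy : y ∈ 𝒞) : (∀ i, y i ∈ X i) ∧ ∀ c, dotIO (a c) y ≤ b c :=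
    (hlcs.subset ⟨h𝒞nn y hy, y, hy, fun _ _ => le_rfl⟩).2
  have hcost (y : I → O → ℝ) (hy : y ∈ 𝒞) :
      ∑ i, dotO (pers a p i) (y i) ≤ ∑ i, dotO (pers a p i) (x i) := by
    rw [hvalue, sum_dotO_pers]
    exact Finset.sum_le_sum fun c _ => mul_le_mul_of_nonneg_left ((h𝒞feas y hy).2 c) (hp c)
  have hpers (i : I) (l : O) : 0 ≤ pers a p i l :=
    Finset.sum_nonneg fun c _ => mul_nonneg (ha c i l) (hp c)
  obtain ⟨-, x', hx', hle⟩ := hlcs.superset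
    (show x ∈ _ from ⟨fun i => hXnn i _ (hxX i), hxX, fun c => sub_nonpos.1 (hfeas c)⟩)
  have hcost_eq := (Finset.sum_eq_sum_iff_of_le fun i _ => dotO_le_dotO (hpers i) (hle i)).1
    ((Finset.sum_le_sum fun i _ => dotO_le_dotO (hpers i) (hle i)).antisymm (hcost x' hx'))
  have hxx' : x = x' := by
    funext i
    by_contra hne
    refine (hu_mono i (x' i) (h𝒞nn x' hx' i) (x i) (hXnn i _ (hxX i)) (hle i) hne).not_ge ?_
    exact hopt i (x' i) ((h𝒞feas x' hx').1 i)
      ((hcost_eq i (Finset.mem_univ i)).symm.trans_le (hcons i).1)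
  refine ⟨x, p, hp, fun i => ⟨hxX i, (hcons i).1, hopt i⟩, hxx' ▸ hx', fun c hc => ?_, ?_⟩
  · exact (mul_eq_zero.1 (hslack c)).resolve_right (sub_neg.2 hc).ne
  · rintro ⟨y, hy, hyu⟩
    have hlt : ∑ i : I, (1 : ℝ) < ∑ i, dotO (pers a p i) (y i) :=
      Finset.sum_lt_sum_of_nonempty Finset.univ_nonempty fun i _ => by
        by_contra! h
        exact (hyu i).not_ge (hopt i (y i) ((h𝒞feas y hy).1 i) h)
    have := hcost y hy
    simp only [Finset.sum_const, Finset.card_univ, nsmul_eq_mul, mul_one] at hlt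
    linarith
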